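/- Let {L_t} and {D_t}, t ∈ [0,1], be homotopies of a continuous curve L_t : [0,1] → ℝ^{n+1} and a continuous disk D_t : Dⁿ → ℝ^{n+1}, such that L₀ and D₀ are C¹ embeddings intersecting in exactly one point, transversely, and such that the images of L₁ and D₁ are disjoint. Then there exists t ∈ [0,1] such that either L_t intersects D_t restricted to ∂Dⁿ, or one of the endpoints L_t(0), L_t(1) lies in the image of D_t. -/

import Mathlib

open Metric
open MeasureTheory Set Filter Topology
open scoped NNReal ContDiff

/-- For endomorphisms of a fixed space, `det (1 + A)` is a fixed affine combination of the values
`det (1 + t A)` at finitely many prescribed small parameters `t`. -/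
theorem exists_det_one_add_eq_sum {V : Type*} [NormedAddCommGroup V] [NormedSpace ℝ V]
    [FiniteDimensional ℝ V] {ε : ℝ} (hε : 0 < ε) :
    ∃ (s : Finset ℕ) (c t : ℕ → ℝ), ∑ i ∈ s, c i = 1 ∧ (∀ i ∈ s, 0 < t i ∧ t i < ε) ∧
      ∀ A : V →L[ℝ] V, (1 + A).det = ∑ i ∈ s, c i * (1 + t i • A).det := by
  set d := Module.finrank ℝ V
  let t : ℕ → ℝ := fun i => ε / (i + 2)
  have ht : Function.Injective t := by
    intro i j hij
    have hi : (0:ℝ) < i + 2 := by positivity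
    have hj : (0:ℝ) < j + 2 := by positivity
    simp only [t] at hij
    rw [div_eq_div_iff hi.ne' hj.ne'] at hij
    have := mul_left_cancel₀ hε.ne' hij
    exact_mod_cast (by linarith : (i:ℝ) = j)
  have hs : (Finset.range (d + 1)).Nonempty := ⟨0, by simp⟩
  refine ⟨Finset.range (d + 1),
    fun i => (Lagrange.basis (Finset.range (d + 1)) t i).eval 1, t, ?_, ?_, ?_⟩
  · rw [← Polynomial.eval_finsetSum, Lagrange.sum_basis ht.injOn hs]
    simp
  · intro i _
    refine ⟨by positivity, ?_⟩
    rw [div_lt_iff₀ (by positivity)]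
    nlinarith [(Nat.cast_nonneg i : (0:ℝ) ≤ i)]
  · intro A
    let b := Module.finBasis ℝ V
    let M := LinearMap.toMatrix b b A.toLinearMap
    let p : Polynomial ℝ := ((Polynomial.X : Polynomial ℝ) • M.map Polynomial.C
      + (1 : Matrix (Fin d) (Fin d) ℝ).map Polynomial.C).det
    have hp : ∀ r : ℝ, p.eval r = (1 + r • A).det := by
      intro r
      have h1 : (1 + r • A).det = (LinearMap.toMatrix b b (1 + r • A).toLinearMap).det := by
        rw [LinearMap.det_toMatrix]
      rw [h1]
      simp only [p]
      rw [← Polynomial.coe_evalRingHom, RingHom.map_det]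
      congr 1
      ext i j
      simp only [Matrix.map_apply, Matrix.add_apply, Matrix.smul_apply, RingHom.mapMatrix_apply]
      by_cases hij : i = j
      · subst hij
        simp [M, LinearMap.toMatrix_one]
        ring
      · simp [M, LinearMap.toMatrix_one, hij]
        ring
    have hdeg : p.degree < (Finset.range (d + 1)).card := by
      refine lt_of_le_of_lt Polynomial.degree_le_natDegree ?_
      have := Polynomial.natDegree_det_X_add_C_le M (1 : Matrix (Fin d) (Fin d) ℝ)
      rw [Finset.card_range]
      simp only [Fintype.card_fin] at this
      exact_mod_cast Nat.lt_succ_of_le this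
    have h := congrArg (Polynomial.eval 1) (Lagrange.eq_interpolate ht.injOn hdeg)
    rw [Lagrange.interpolate_apply, Polynomial.eval_finsetSum, hp, one_smul] at h
    rw [h]
    refine Finset.sum_congr rfl fun i _ => ?_
    rw [Polynomial.eval_mul, Polynomial.eval_C, hp, mul_comm]

/-- A Lipschitz perturbation of the identity with small Lipschitz constant, supported in a ball,
maps that ball onto itself bijectively. -/
theorem bijOn_ball_id_add {V : Type*} [NormedAddCommGroup V] [NormedSpace ℝ V]
    [CompleteSpace V] {g : V → V} {c : ℝ≥0} (hg : LipschitzWith c g) (hc : c < 1) {R : ℝ}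
    (hsupp : ∀ x, R ≤ ‖x‖ → g x = 0) :
    BijOn (fun x => x + g x) (ball 0 R) (ball 0 R) := by
  have happ : ApproximatesLinearOn (fun x => x + g x)
      ((ContinuousLinearEquiv.refl ℝ V : V ≃L[ℝ] V) : V →L[ℝ] V) univ c := by
    rw [ApproximatesLinearOn.approximatesLinearOn_iff_lipschitzOnWith, lipschitzOnWith_univ]
    convert hg using 1
    ext x
    simp
  have hc' : Subsingleton V ∨
      c < ‖((ContinuousLinearEquiv.refl ℝ V).symm : V →L[ℝ] V)‖₊⁻¹ := by
    rcases subsingleton_or_nontrivial V with h | h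
    · exact Or.inl h
    · right
      have : ‖((ContinuousLinearEquiv.refl ℝ V).symm : V →L[ℝ] V)‖₊ = 1 := by
        ext
        exact ContinuousLinearMap.norm_id
      rwa [this, inv_one]
  have hbij : Function.Bijective fun x => x + g x := (happ.toHomeomorph _ hc').bijective
  have hout : ∀ x, x ∉ ball (0 : V) R → x + g x = x := fun x hx => by
    rw [hsupp x (by simpa using hx), add_zero]
  refine ⟨fun x hx => ?_, hbij.1.injOn, fun y hy => ?_⟩
  · by_contra hfx
    have := hbij.1 (hout _ hfx)
    exact hfx (this.symm ▸ hx)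
  · obtain ⟨x, rfl⟩ := hbij.2 y
    refine ⟨x, ?_, rfl⟩
    by_contra hx
    exact hx (hout x hx ▸ hy)

/-- The integral of the Jacobian determinant of a Lipschitz map which agrees with the identity
outside a ball is the volume of the ball. -/
theorem setIntegral_det_one_add_fderiv {V : Type*} [NormedAddCommGroup V] [NormedSpace ℝ V]
    [FiniteDimensional ℝ V] [MeasurableSpace V] [BorelSpace V] (μ : Measure V)
    [μ.IsAddHaarMeasure] {g : V → V} {C : ℝ≥0} (hg : LipschitzWith C g) {R : ℝ}
    (hsupp : ∀ x, R ≤ ‖x‖ → g x = 0) (hdiff : DifferentiableOn ℝ g (ball 0 R)) :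
    ∫ x in ball 0 R, (1 + fderiv ℝ g x).det ∂μ = μ.real (ball 0 R) := by
  have hcont : Continuous fun A : V →L[ℝ] V => A.det := ContinuousLinearMap.continuous_det
  have hpos : ∀ᶠ A : V →L[ℝ] V in 𝓝 1, 0 < A.det := by
    refine hcont.continuousAt.eventually (lt_mem_nhds ?_)
    simp [ContinuousLinearMap.det]
  obtain ⟨r, hr, hrpos⟩ := Metric.eventually_nhds_iff.1 hpos
  have hC : (0 : ℝ) < C + 1 := by positivity
  have hε : 0 < min r 1 / (C + 1) := by positivity
  obtain ⟨s, c, t, hsum, ht, hdet⟩ := exists_det_one_add_eq_sum (V := V) hε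
  have hbound : ∀ x, ‖fderiv ℝ g x‖ ≤ C := fun x => norm_fderiv_le_of_lipschitz ℝ hg
  have hint : ∀ τ : ℝ,
      IntegrableOn (fun x => (1 + τ • fderiv ℝ g x).det) (ball 0 R) μ := by
    intro τ
    have hcont' : Continuous fun A : V →L[ℝ] V => (1 + τ • A).det :=
      hcont.comp (continuous_const.add (continuous_id.const_smul τ))
    obtain ⟨K, hK⟩ := (isCompact_closedBall (0 : V →L[ℝ] V) C).exists_bound_of_continuousOn
      hcont'.continuousOn
    refine Measure.integrableOn_of_bounded (M := K) measure_ball_lt_top.ne ?_ ?_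
    · exact (hcont'.measurable.comp (measurable_fderiv ℝ g)).aestronglyMeasurable
    · exact Eventually.of_forall fun x => hK _ (by simpa using hbound x)
  have hsmall : ∀ i ∈ s,
      ∫ x in ball 0 R, (1 + t i • fderiv ℝ g x).det ∂μ = μ.real (ball 0 R) := by
    intro i hi
    obtain ⟨ht0, htε⟩ := ht i hi
    rw [lt_div_iff₀ hC] at htε
    have htC : t i * C < min r 1 := by nlinarith
    have hlip : LipschitzWith (‖t i‖₊ * C) fun x => t i • g x :=
      (lipschitzWith_smul (t i)).comp hg
    have hlt : ‖t i‖₊ * C < 1 := by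
      rw [← NNReal.coe_lt_coe]
      simpa [abs_of_pos ht0] using htC.trans_le (min_le_right _ _)
    have hbij := bijOn_ball_id_add (R := R) hlip hlt fun x hx => by simp [hsupp x hx]
    have hder : ∀ x ∈ ball (0 : V) R, HasFDerivWithinAt (fun x => x + t i • g x)
        (1 + t i • fderiv ℝ g x) (ball 0 R) x := fun x hx =>
      ((hasFDerivAt_id x).add (((hdiff.differentiableAt
        (isOpen_ball.mem_nhds hx)).hasFDerivAt).const_smul (t i))).hasFDerivWithinAt
    have hcv := integral_image_eq_integral_abs_det_fderiv_smul μ measurableSet_ball hder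
      hbij.injOn fun _ => (1 : ℝ)
    rw [hbij.image_eq] at hcv
    simp only [smul_eq_mul, mul_one, integral_const, MeasurableSet.univ,
      measureReal_restrict_apply, univ_inter] at hcv
    rw [hcv]
    refine setIntegral_congr_fun measurableSet_ball fun x _ => (abs_of_pos (hrpos ?_)).symm
    rw [dist_eq_norm, add_sub_cancel_left, norm_smul, Real.norm_of_nonneg ht0.le]
    have := mul_le_mul_of_nonneg_left (hbound x) ht0.le
    linarith [min_le_left r 1]
  rw [funext fun x => hdet (fderiv ℝ g x),
    integral_finsetSum _ fun i _ => (hint (t i)).const_mul (c i)]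
  simp only [integral_const_mul]
  rw [Finset.sum_congr rfl fun i hi => by rw [hsmall i hi], ← Finset.sum_mul, hsum, one_mul]

/-- The radial retraction `y ↦ y / max 1 ‖y‖` onto the closed unit ball is Lipschitz. -/
theorem lipschitzWith_inv_max_one_norm_smul {V : Type*} [NormedAddCommGroup V]
    [NormedSpace ℝ V] : LipschitzWith 2 fun y : V => (max 1 ‖y‖)⁻¹ • y := by
  refine LipschitzWith.of_dist_le_mul fun y z => ?_
  rw [dist_eq_norm, dist_eq_norm]
  set a := max 1 ‖y‖ with ha
  set b := max 1 ‖z‖ with hb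
  have ha1 : 1 ≤ a := le_max_left _ _
  have hb1 : 1 ≤ b := le_max_left _ _
  have hzb : ‖z‖ ≤ b := le_max_right _ _
  have hab : |b - a| ≤ ‖y - z‖ := by
    refine (abs_max_sub_max_le_max 1 ‖z‖ 1 ‖y‖).trans ?_
    rw [sub_self, abs_zero, norm_sub_rev]
    exact max_le (norm_nonneg _) (abs_norm_sub_norm_le z y)
  have hdecomp : a⁻¹ • y - b⁻¹ • z = a⁻¹ • (y - z) + ((b - a) * (a⁻¹ * b⁻¹)) • z := by
    have : (b - a) * (a⁻¹ * b⁻¹) = a⁻¹ - b⁻¹ := by field_simp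
    rw [this, smul_sub, sub_smul]
    abel
  have hainv : a⁻¹ ≤ 1 := inv_le_one_of_one_le₀ ha1
  have hbz : b⁻¹ * ‖z‖ ≤ 1 := by rw [inv_mul_le_iff₀ (by linarith)]; linarith
  have hapos : 0 < a⁻¹ := by positivity
  have hbpos : 0 < b⁻¹ := by positivity
  calc ‖a⁻¹ • y - b⁻¹ • z‖ ≤ a⁻¹ * ‖y - z‖ + |b - a| * (a⁻¹ * b⁻¹) * ‖z‖ := by
        rw [hdecomp]
        refine (norm_add_le _ _).trans_eq ?_
        rw [norm_smul, norm_smul, norm_mul, Real.norm_of_nonneg hapos.le,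
          Real.norm_of_nonneg (by positivity : 0 ≤ a⁻¹ * b⁻¹), Real.norm_eq_abs]
    _ = a⁻¹ * ‖y - z‖ + a⁻¹ * (|b - a| * (b⁻¹ * ‖z‖)) := by ring
    _ ≤ 1 * ‖y - z‖ + 1 * (‖y - z‖ * 1) := by gcongr
    _ = ((2 : ℝ≥0) : ℝ) * ‖y - z‖ := by push_cast; ring

/-- A derivative of a map of locally constant nonzero norm is singular. -/
theorem det_eq_zero_of_norm_eventuallyEq {V : Type*} [NormedAddCommGroup V]
    [InnerProductSpace ℝ V] [FiniteDimensional ℝ V] {f : V → V} {f' : V →L[ℝ] V} {x : V}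
    (hf : HasFDerivAt f f' x) {R : ℝ} (hR : 0 < R) (hnorm : ∀ᶠ y in 𝓝 x, ‖f y‖ = R) :
    f'.det = 0 := by
  by_contra hdet
  have hsurj : Function.Surjective f' :=
    (LinearMap.equivOfDetNeZero (f' : V →ₗ[ℝ] V) hdet).surjective
  have h1 : HasFDerivAt (fun y => ‖f y‖ ^ 2) _ x := hf.norm_sq
  have h2 : HasFDerivAt (fun y => ‖f y‖ ^ 2) (0 : V →L[ℝ] ℝ) x :=
    (hasFDerivAt_const (R ^ 2) x).congr_of_eventuallyEq (hnorm.mono fun y hy => by simp [hy])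
  obtain ⟨v, hv⟩ := hsurj (f x)
  have h3 := congrArg (fun A : V →L[ℝ] ℝ => A v) (h1.unique h2)
  have hx : ‖f x‖ = R := hnorm.self_of_nhds
  simp [hv, hx, hR.ne'] at h3

/-- A continuous compactly supported map can be approximated uniformly by smooth maps supported
in a slightly larger ball. -/
theorem exists_contDiff_dist_lt_of_eq_zero {V : Type*} [NormedAddCommGroup V]
    [NormedSpace ℝ V] [FiniteDimensional ℝ V] {g : V → V} (hg : Continuous g) {R : ℝ}
    (hsupp : ∀ x, R ≤ ‖x‖ → g x = 0) {ε : ℝ} (hε : 0 < ε) :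
    ∃ h : V → V, ContDiff ℝ ∞ h ∧ (∀ x, dist (h x) (g x) < ε) ∧
      ∀ x, R + 1 ≤ ‖x‖ → h x = 0 := by
  have hcs : HasCompactSupport g := HasCompactSupport.intro (isCompact_closedBall 0 R)
    fun x hx => hsupp x (by simpa using (not_le.1 (by simpa using hx) : R < ‖x‖).le)
  have huc := hcs.uniformContinuous_of_continuous hg
  obtain ⟨δ, hδ, hgδ⟩ := Metric.uniformContinuous_iff.1 huc (ε / 2) (half_pos hε)
  obtain ⟨h, hh, hdist⟩ := hg.exists_contDiff_dist_le_of_forall_mem_ball_dist_le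
    (lt_min hδ one_pos)
  refine ⟨h, hh, fun x => (hdist x (ε / 2) fun y hy => ?_).trans_lt (half_lt_self hε),
    fun x hx => ?_⟩
  · exact (hgδ ((mem_ball.1 hy).trans_le (min_le_left _ _))).le
  · have hgx : g x = 0 := hsupp x (by linarith)
    rw [← dist_le_zero, ← hgx]
    refine hdist x 0 fun y hy => ?_
    have hy1 : ‖y - x‖ < 1 := by
      rw [← dist_eq_norm]; exact (mem_ball.1 hy).trans_le (min_le_right _ _)
    have := norm_sub_norm_le x y
    rw [norm_sub_rev] at this
    rw [hgx, hsupp y (by linarith), dist_self]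

/-- A continuous self-map of a Euclidean space that agrees with the identity outside a ball has a
zero. -/
theorem exists_eq_zero_of_eq_self_of_le_norm {V : Type*} [NormedAddCommGroup V]
    [InnerProductSpace ℝ V] [FiniteDimensional ℝ V] {m : V → V} (hm : Continuous m) {R : ℝ}
    (hid : ∀ x, R ≤ ‖x‖ → m x = x) : ∃ x, m x = 0 := by
  by_contra! hne
  wlog hR : 0 < R generalizing R
  · exact this (R := 1) (fun x hx => hid x (by linarith)) one_pos
  obtain ⟨δ, hδ, hmδ⟩ : ∃ δ > 0, ∀ x, δ ≤ ‖m x‖ := by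
    obtain ⟨x₁, _, hx₁⟩ := (isCompact_closedBall (0 : V) R).exists_isMinOn
      ⟨0, by simp [hR.le]⟩ hm.norm.continuousOn
    refine ⟨min ‖m x₁‖ R, lt_min (norm_pos_iff.2 (hne x₁)) hR, fun x => ?_⟩
    rcases le_total ‖x‖ R with hx | hx
    · exact (min_le_left _ _).trans (hx₁ (by simpa using hx))
    · exact (min_le_right _ _).trans (by rwa [hid x hx])
  obtain ⟨h, hh, hdist, hhsupp⟩ := exists_contDiff_dist_lt_of_eq_zero
    (g := fun x => m x - x) (R := R) (by fun_prop) (fun x hx => by simp [hid x hx]) (half_pos hδ)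
  set ρ := R + 1
  set ε := δ / 2
  have hρ : 0 < ρ := by positivity
  have hε : 0 < ε := half_pos hδ
  let k : V → V := fun x => x + h x
  have hkε : ∀ x, ε ≤ ‖k x‖ := fun x => by
    have h1 : ‖k x - m x‖ < ε := by
      have := hdist x
      rw [dist_eq_norm] at this
      have heq : k x - m x = h x - (m x - x) := by
        simp only [k]
        abel
      rwa [heq]
    have h2 := norm_sub_norm_le (m x) (k x)
    rw [norm_sub_rev] at h2
    have h3 := hmδ x
    simp only [ε] at h1 ⊢
    linarith
  have hkout : ∀ x, ρ ≤ ‖x‖ → k x = x := fun x hx => by simp [k, hhsupp x hx]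
  let P : V → V := fun y => (max 1 ‖y‖)⁻¹ • y
  have hP : ∀ y : V, ∀ a > 0, a ≤ ‖y‖ → P (a⁻¹ • y) = ‖y‖⁻¹ • y := fun y a ha hay => by
    have h1 : ‖a⁻¹ • y‖ = a⁻¹ * ‖y‖ := by rw [norm_smul, Real.norm_of_nonneg (by positivity)]
    have h2 : 1 ≤ a⁻¹ * ‖y‖ := by rwa [le_inv_mul_iff₀ ha, mul_one]
    simp only [P]
    rw [h1, max_eq_right h2, smul_smul]
    congr 1
    have : ‖y‖ ≠ 0 := by linarith
    field_simp
  let g : V → V := fun x => ρ • P (ε⁻¹ • k x) - ρ • P (ρ⁻¹ • x)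
  have hhcs : HasCompactSupport h := HasCompactSupport.intro (isCompact_closedBall 0 ρ)
    fun x hx => hhsupp x (by simpa using (not_le.1 (by simpa using hx) : ρ < ‖x‖).le)
  obtain ⟨C, hC⟩ := hh.lipschitzWith_of_hasCompactSupport hhcs (by simp)
  have hPlip : LipschitzWith 2 P := lipschitzWith_inv_max_one_norm_smul
  have hglip := ((lipschitzWith_smul ρ).comp (hPlip.comp ((lipschitzWith_smul ε⁻¹).comp
    (LipschitzWith.id.add hC)))).sub
    ((lipschitzWith_smul ρ).comp (hPlip.comp (lipschitzWith_smul (β := V) ρ⁻¹)))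
  have hgout : ∀ x, ρ ≤ ‖x‖ → g x = 0 := fun x hx => by
    have hk := hkε x
    rw [hkout x hx] at hk
    simp only [g]
    rw [hkout x hx, hP x ε hε hk, hP x ρ hρ hx, sub_self]
  have hgin : ∀ x ∈ ball (0 : V) ρ, x + g x = ρ • ‖k x‖⁻¹ • k x := fun x hx => by
    have hx' : ‖x‖ < ρ := by simpa using hx
    have : ‖ρ⁻¹ • x‖ ≤ 1 := by
      rw [norm_smul, Real.norm_of_nonneg (by positivity), inv_mul_le_iff₀ hρ]; linarith
    simp only [g]
    rw [hP (k x) ε hε (hkε x)]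
    simp only [P]
    rw [max_eq_left this, inv_one, one_smul, smul_inv_smul₀ hρ.ne']
    abel
  have hkne : ∀ x, k x ≠ 0 := fun x => norm_pos_iff.1 (hε.trans_le (hkε x))
  have hgdiff : DifferentiableOn ℝ g (ball 0 ρ) := by
    have hk : Differentiable ℝ k := differentiable_id.add (hh.differentiable (by simp))
    have hd : Differentiable ℝ fun x => ρ • ‖k x‖⁻¹ • k x - x := fun x =>
      ((((hk x).norm ℝ (hkne x)).inv (norm_ne_zero_iff.2 (hkne x))).smul (hk x)).const_smul ρ
        |>.sub differentiableAt_id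
    refine hd.differentiableOn.congr fun x hx => ?_
    rw [← hgin x hx]
    abel
  borelize V
  have hvol := setIntegral_det_one_add_fderiv Measure.addHaar hglip hgout hgdiff
  rw [setIntegral_congr_fun (g := fun _ => (0 : ℝ)) measurableSet_ball, integral_zero] at hvol
  · exact (ENNReal.toReal_pos (measure_ball_pos Measure.addHaar (0 : V) hρ).ne'
      measure_ball_lt_top.ne).ne hvol
  · intro x hx
    have hgx : HasFDerivAt g (fderiv ℝ g x) x :=
      (hgdiff.differentiableAt (isOpen_ball.mem_nhds hx)).hasFDerivAt
    refine det_eq_zero_of_norm_eventuallyEq ((hasFDerivAt_id x).add hgx) hρ ?_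
    filter_upwards [isOpen_ball.mem_nhds hx] with y hy
    change ‖y + g y‖ = ρ
    rw [hgin y hy, norm_smul, norm_smul, norm_inv, norm_norm,
      inv_mul_cancel₀ (norm_ne_zero_iff.2 (hkne y)), mul_one, Real.norm_of_nonneg hρ.le]

/-- A homotopy on a convex body that never vanishes on the boundary and starts at a map whose only
zero is the origin, with identity derivative there, cannot end at a nowhere vanishing map. -/
theorem exists_eq_zero_of_homotopy_of_hasFDerivAt_one {V : Type*} [NormedAddCommGroup V]
    [InnerProductSpace ℝ V] [FiniteDimensional ℝ V] {K : Set V} (hK : IsCompact K)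
    (hconv : Convex ℝ K) (hK0 : K ∈ 𝓝 0) {H : ℝ → V → V}
    (hH : Continuous (Function.uncurry H))
    (hfr : ∀ t ∈ Icc (0 : ℝ) 1, ∀ v ∈ frontier K, H t v ≠ 0) (hzero : H 0 0 = 0)
    (huniq : ∀ v ∈ K, H 0 v = 0 → v = 0) (hder : HasFDerivAt (H 0) (1 : V →L[ℝ] V) 0) :
    ∃ v ∈ K, H 1 v = 0 := by
  by_contra! hend
  let q := gauge K
  have hqcont : Continuous q := continuous_gauge hconv hK0
  have hq0 : ∀ z, 0 ≤ q z := gauge_nonneg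
  let M : V → ℝ := fun z => max (max 1 (q z)) (q z ^ 2 / 2)
  have hM1 : ∀ z, 1 ≤ M z := fun z => (le_max_left _ _).trans (le_max_left _ _)
  have hMpos : ∀ z, 0 < M z := fun z => one_pos.trans_le (hM1 z)
  have hMcont : Continuous M := by fun_prop
  have hgauge : ∀ z, q ((M z)⁻¹ • z) = (M z)⁻¹ * q z := fun z =>
    gauge_smul_of_nonneg (inv_nonneg.2 (hMpos z).le) z
  have hmem : ∀ z, (M z)⁻¹ • z ∈ K := fun z => by
    rw [← hK.isClosed.closure_eq, ← gauge_le_one_iff_mem_closure hconv hK0]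
    change q _ ≤ 1
    rw [hgauge, inv_mul_le_iff₀ (hMpos z), mul_one]
    exact (le_max_right _ _).trans (le_max_left _ _)
  let Φ : V → V := fun z => H (max 0 (min 1 (2 - q z))) ((M z)⁻¹ • z)
  have hΦcont : Continuous Φ := by
    refine hH.comp (Continuous.prodMk (by fun_prop) ?_)
    exact (hMcont.inv₀ fun z => (hMpos z).ne').smul continuous_id
  have hΦ2 : ∀ z, 2 ≤ q z → Φ z = H 0 ((M z)⁻¹ • z) := fun z hz => by
    simp only [Φ]
    rw [max_eq_left ((min_le_right _ _).trans (by linarith))]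
  have hΦne : ∀ z, Φ z ≠ 0 := by
    intro z
    rcases le_total (q z) 1 with h1 | h1
    · have : max 0 (min 1 (2 - q z)) = 1 := by
        rw [min_eq_left (by linarith), max_eq_right zero_le_one]
      simp only [Φ, this]
      exact hend _ (hmem z)
    rcases le_total (q z) 2 with h2 | h2
    · refine hfr _ ⟨le_max_left _ _, max_le zero_le_one (min_le_left _ _)⟩ _ ?_
      rw [← gauge_eq_one_iff_mem_frontier hconv hK0]
      change q _ = 1
      have : M z = q z := by
        simp only [M]
        rw [max_eq_right h1, max_eq_left (by nlinarith)]
      rw [hgauge, this, inv_mul_cancel₀ (by linarith)]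
    · rw [hΦ2 z h2]
      intro h
      have hz : z = 0 := by
        simpa [(hMpos z).ne'] using huniq _ (hmem z) h
      have : q z = 0 := by rw [hz]; exact gauge_zero
      linarith
  obtain ⟨r, hr, hKr⟩ : ∃ r > 0, K ⊆ closedBall 0 r := by
    obtain ⟨r, hr⟩ := hK.isBounded.subset_closedBall (0 : V)
    exact ⟨max r 1, by positivity, hr.trans (closedBall_subset_closedBall (le_max_left _ _))⟩
  have hqr : ∀ z, ‖z‖ / r ≤ q z := fun z =>
    le_gauge_of_subset_closedBall (absorbent_nhds_zero hK0) hr.le hKr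
  obtain ⟨η, hη, hclose⟩ : ∃ η > 0, ∀ w : V, ‖w‖ < η → ‖H 0 w - w‖ ≤ 1 / 2 * ‖w‖ := by
    have := (hasFDerivAt_iff_isLittleO_nhds_zero.1 hder).def (half_pos one_pos)
    obtain ⟨η, hη, h⟩ := Metric.eventually_nhds_iff.1 this
    refine ⟨η, hη, fun w hw => ?_⟩
    simpa [hzero] using h (y := w) (by simpa using hw)
  obtain ⟨R, hR⟩ : ∃ R : ℝ, ∀ z : V, R ≤ ‖z‖ → 0 < inner ℝ (Φ z) z := by
    refine ⟨max (2 * r) (2 * r ^ 2 / η + 1), fun z hz => ?_⟩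
    have hz1 : 2 * r ≤ ‖z‖ := (le_max_left _ _).trans hz
    have hz2 : 2 * r ^ 2 / η + 1 ≤ ‖z‖ := (le_max_right _ _).trans hz
    have hzpos : 0 < ‖z‖ := by linarith
    have hq2 : 2 ≤ q z := ((le_div_iff₀ hr).2 hz1).trans (hqr z)
    have hMz : M z = q z ^ 2 / 2 := by
      simp only [M]
      rw [max_eq_right]
      exact max_le (by nlinarith) (by nlinarith)
    have hMlow : (‖z‖ / r) ^ 2 / 2 ≤ M z := by
      rw [hMz]
      have := hqr z
      gcongr
    set w := (M z)⁻¹ • z with hw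
    have hwnorm : ‖w‖ = (M z)⁻¹ * ‖z‖ := by
      rw [hw, norm_smul, Real.norm_of_nonneg (inv_nonneg.2 (hMpos z).le)]
    have hwη : ‖w‖ < η := by
      rw [hwnorm, inv_mul_lt_iff₀ (hMpos z)]
      have h1 : 2 * r ^ 2 < ‖z‖ * η := by
        rw [← div_lt_iff₀ hη]; linarith
      have h2 : ‖z‖ < (‖z‖ / r) ^ 2 / 2 * η := by
        rw [div_pow, div_div, div_mul_eq_mul_div, lt_div_iff₀ (by positivity)]
        nlinarith
      exact h2.trans_le (by gcongr)
    have hwpos : 0 < ‖w‖ := by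
      rw [hwnorm]; have := hMpos z; positivity
    have hzw : z = M z • w := by rw [hw, smul_inv_smul₀ (hMpos z).ne']
    have hin : 0 < inner ℝ (H 0 w) w := by
      have h1 : inner ℝ (H 0 w) w = inner ℝ (H 0 w - w) w + ‖w‖ ^ 2 := by
        rw [inner_sub_left, real_inner_self_eq_norm_sq]; ring
      have h2 := neg_le_of_abs_le (abs_real_inner_le_norm (H 0 w - w) w)
      have h3 := mul_le_mul_of_nonneg_right (hclose w hwη) hwpos.le
      rw [h1]
      nlinarith
    rw [hΦ2 z hq2, ← hw, hzw, inner_smul_right]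
    exact mul_pos (hMpos z) hin
  let s : V → ℝ := fun z => max 0 (min 1 (‖z‖ - R))
  have hs0 : ∀ z, 0 ≤ s z := fun z => le_max_left _ _
  have hs1 : ∀ z, s z ≤ 1 := fun z => max_le zero_le_one (min_le_left _ _)
  obtain ⟨z, hz⟩ := exists_eq_zero_of_eq_self_of_le_norm
    (m := fun z => (1 - s z) • Φ z + s z • z) (R := R + 1) (by fun_prop) fun z hz => by
      have : s z = 1 := by
        simp only [s]
        rw [min_eq_left (by linarith), max_eq_right zero_le_one]
      simp [this]
  rcases le_total ‖z‖ R with h | h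
  · have : s z = 0 := by
      simp only [s]
      rw [max_eq_left ((min_le_right _ _).trans (by linarith))]
    exact hΦne z (by simpa [this] using hz)
  · have h1 := congrArg (fun v => inner ℝ v z) hz
    simp only [inner_add_left, real_inner_smul_left, inner_zero_left,
      real_inner_self_eq_norm_sq] at h1
    have h2 := hR z h
    have h3 : z ≠ 0 := fun h0 => by simp [h0] at h2
    have h4 : 0 < ‖z‖ ^ 2 := by positivity
    rcases (hs0 z).eq_or_lt with h5 | h5
    · rw [← h5] at h1
      linarith
    · nlinarith [mul_pos h5 h4, mul_nonneg (sub_nonneg.2 (hs1 z)) h2.le]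

/-- A homotopy on a convex body that never vanishes on the boundary and starts at a map with
exactly one zero, interior and nondegenerate, cannot end at a nowhere vanishing map. -/
theorem exists_eq_zero_of_homotopy_of_nondegenerate {E V : Type*} [NormedAddCommGroup E]
    [NormedSpace ℝ E] [NormedAddCommGroup V] [InnerProductSpace ℝ V] [FiniteDimensional ℝ V]
    {B : Set E} (hB : IsCompact B) (hconv : Convex ℝ B) {p : E} (hp : B ∈ 𝓝 p)
    {F : ℝ → E → V} (hF : Continuous (Function.uncurry F))
    (hfr : ∀ t ∈ Icc (0 : ℝ) 1, ∀ b ∈ frontier B, F t b ≠ 0) (hzero : F 0 p = 0)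
    (huniq : ∀ b ∈ B, F 0 b = 0 → b = p) {A : E ≃L[ℝ] V}
    (hder : HasFDerivAt (F 0) (A : E →L[ℝ] V) p) :
    ∃ b ∈ B, F 1 b = 0 := by
  let φ : V ≃ₜ E := A.symm.toHomeomorph.trans (Homeomorph.addLeft p)
  have hφ : ∀ v, φ v = p + A.symm v := fun v => rfl
  have hφ0 : φ 0 = p := by simp [hφ]
  have hφder : HasFDerivAt φ (A.symm : V →L[ℝ] E) 0 :=
    (A.symm.hasFDerivAt (x := 0)).const_add p
  obtain ⟨v, hv, hv0⟩ := exists_eq_zero_of_homotopy_of_hasFDerivAt_one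
    (K := φ ⁻¹' B) (H := fun t v => F t (φ v)) (φ.isCompact_preimage.2 hB)
    ((hconv.translate_preimage_right p).linear_preimage (A.symm : V →L[ℝ] E).toLinearMap)
    (φ.continuous.continuousAt.preimage_mem_nhds (by rwa [hφ0]))
    (hF.comp (continuous_fst.prodMk (φ.continuous.comp continuous_snd)))
    (fun t ht v hv => hfr t ht _ (by rwa [← φ.preimage_frontier] at hv))
    (by simpa only [hφ0] using hzero)
    (fun v hv h => φ.injective ((huniq _ hv h).trans hφ0.symm))
    (by
      have h := (hφ0.symm ▸ hder : HasFDerivAt (F 0) (A : E →L[ℝ] V) (φ 0)).comp 0 hφder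
      rwa [ContinuousLinearEquiv.coe_comp_coe_symm] at h)
  exact ⟨_, hv, hv0⟩

/-- Degree-theoretic separation lemma: if homotopies `L_t` of a curve and `D_t` of an
`n`-disk start from `C¹` embeddings intersecting exactly once and transversely, and end
disjoint, then at some time the curve meets the boundary of the disk, or an endpoint of
the curve meets the disk. -/
theorem curve_disk_homotopy_boundary_intersection {n : ℕ}
    (L : ℝ → ℝ → EuclideanSpace ℝ (Fin (n + 1)))
    (D : ℝ → EuclideanSpace ℝ (Fin n) → EuclideanSpace ℝ (Fin (n + 1)))
    (hLcont : Continuous (Function.uncurry L))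
    (hDcont : Continuous (Function.uncurry D))
    (hL0 : ContDiff ℝ 1 (L 0)) (hD0 : ContDiff ℝ 1 (D 0))
    (hLinj : Set.InjOn (L 0) (Set.Icc 0 1))
    (hDinj : Set.InjOn (D 0) (closedBall 0 1))
    (x₀ : ℝ) (y₀ : EuclideanSpace ℝ (Fin n))
    (hx₀ : x₀ ∈ Set.Icc (0:ℝ) 1)
    (hy₀ : y₀ ∈ closedBall (0 : EuclideanSpace ℝ (Fin n)) 1)
    (hmeet : L 0 x₀ = D 0 y₀)
    (huniq : ∀ x ∈ Set.Icc (0:ℝ) 1, ∀ y ∈ closedBall (0 : EuclideanSpace ℝ (Fin n)) 1,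
      L 0 x = D 0 y → x = x₀ ∧ y = y₀)
    (htrans : Function.Surjective
      (fderiv ℝ (fun p : ℝ × EuclideanSpace ℝ (Fin n) => D 0 p.2 - L 0 p.1) (x₀, y₀)))
    (hdisj : ∀ x ∈ Set.Icc (0:ℝ) 1, ∀ y ∈ closedBall (0 : EuclideanSpace ℝ (Fin n)) 1,
      L 1 x ≠ D 1 y) :
    ∃ t ∈ Set.Icc (0:ℝ) 1,
      (∃ x ∈ Set.Icc (0:ℝ) 1, ∃ y ∈ sphere (0 : EuclideanSpace ℝ (Fin n)) 1,
        L t x = D t y) ∨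
      (∃ y ∈ closedBall (0 : EuclideanSpace ℝ (Fin n)) 1,
        L t 0 = D t y ∨ L t 1 = D t y) := by
  by_contra! hcon
  have hx₀' : x₀ ∈ Set.Ioo (0 : ℝ) 1 := by
    have h := (hcon 0 (by simp)).2 y₀ hy₀
    refine ⟨hx₀.1.lt_of_ne ?_, hx₀.2.lt_of_ne ?_⟩
    · rintro rfl
      exact h.1 hmeet
    · rintro rfl
      exact h.2 hmeet
  have hy₀' : y₀ ∈ ball (0 : EuclideanSpace ℝ (Fin n)) 1 := by
    refine mem_ball.2 (lt_of_le_of_ne (mem_closedBall.1 hy₀) fun h => ?_)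
    exact (hcon 0 (by simp)).1 x₀ hx₀ y₀ h hmeet
  let F : ℝ → ℝ × EuclideanSpace ℝ (Fin n) → EuclideanSpace ℝ (Fin (n + 1)) :=
    fun t p => D t p.2 - L t p.1
  have hF : Continuous (Function.uncurry F) :=
    (hDcont.comp (continuous_fst.prodMk (continuous_snd.comp continuous_snd))).sub
      (hLcont.comp (continuous_fst.prodMk (continuous_fst.comp continuous_snd)))
  have hrank : Module.finrank ℝ (ℝ × EuclideanSpace ℝ (Fin n)) =
      Module.finrank ℝ (EuclideanSpace ℝ (Fin (n + 1))) := by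
    simp [add_comm]
  have hinj := (LinearMap.injective_iff_surjective_of_finrank_eq_finrank hrank
    (f := (fderiv ℝ (F 0) (x₀, y₀)).toLinearMap)).2 htrans
  let A := (LinearEquiv.ofBijective (fderiv ℝ (F 0) (x₀, y₀)).toLinearMap
    ⟨hinj, htrans⟩).toContinuousLinearEquiv
  have hdiff : Differentiable ℝ (F 0) :=
    ((hD0.differentiable one_ne_zero).comp differentiable_snd).sub
      ((hL0.differentiable one_ne_zero).comp differentiable_fst)
  have hder : HasFDerivAt (F 0) (A : ℝ × EuclideanSpace ℝ (Fin n) →L[ℝ] _) (x₀, y₀) :=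
    (hdiff (x₀, y₀)).hasFDerivAt
  obtain ⟨⟨x, y⟩, ⟨hx, hy⟩, hxy⟩ := exists_eq_zero_of_homotopy_of_nondegenerate
    (B := Set.Icc (0 : ℝ) 1 ×ˢ closedBall (0 : EuclideanSpace ℝ (Fin n)) 1)
    (isCompact_Icc.prod (isCompact_closedBall 0 1))
    ((convex_Icc 0 1).prod (convex_closedBall 0 1))
    (prod_mem_nhds (Icc_mem_nhds hx₀'.1 hx₀'.2) (closedBall_mem_nhds_of_mem hy₀')) hF
    (by
      rintro t ht ⟨x, y⟩ hb
      rw [frontier_prod_eq, frontier_Icc zero_le_one, frontier_closedBall _ one_ne_zero,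
        isClosed_Icc.closure_eq, isClosed_closedBall.closure_eq] at hb
      refine sub_ne_zero.2 fun h => ?_
      rcases hb with ⟨hx, hy⟩ | ⟨hx, hy⟩
      · exact (hcon t ht).1 x hx y hy h.symm
      · rcases hx with rfl | rfl
        · exact ((hcon t ht).2 y hy).1 h.symm
        · exact ((hcon t ht).2 y hy).2 h.symm)
    (sub_eq_zero.2 hmeet.symm)
    (fun b hb h => Prod.ext_iff.2 (huniq b.1 hb.1 b.2 hb.2 (sub_eq_zero.1 h).symm))
    hder
  exact hdisj x hx y hy (sub_eq_zero.1 hxy).symm
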